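/- Let M₁ = (P,p₀,δ₁) and M₂ = (Q,q₀,δ₂) be two communicating machines such that all branches of the simulation tree simtree(M₁,M₂) are successful. Then the relation ℛ = {(p,T) ∈ P × 𝒯_Q | some node n of simtree(M₁,M₂) has ℒ(n) = (p,T)} is an asynchronous subtyping relation; in particular, since ℒ(n₀) = (p₀,q₀), it follows that M₁ ≤ M₂. -/

import Mathlib

namespace AsyncSession

/-- Actions: send `!a` or receive `?a` over an alphabet `A`. -/
inductive Act (A : Type) : Type
  | send : A → Act A
  | recv : A → Act A

/-- Direction of an action: `true` for send, `false` for receive. -/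
def Act.dir {A : Type} : Act A → Bool
  | .send _ => true
  | .recv _ => false

/-- A (deterministic, directed) communicating machine with states `S`
    over alphabet `A`. -/
structure Machine (A S : Type) where
  init : S
  trans : S → Act A → S → Prop
  directed : ∀ q ℓ q' ℓ' q'', trans q ℓ q' → trans q ℓ' q'' → Act.dir ℓ = Act.dir ℓ'
  deterministic : ∀ q ℓ q' q'', trans q ℓ q' → trans q ℓ q'' → q' = q''

variable {A P Q S V W' : Type}

/-- A state is final iff it has no outgoing transitions. -/
def Machine.Final (M : Machine A S) (q : S) : Prop := ∀ ℓ q', ¬ M.trans q ℓ q'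

/-- A state is sending iff it is not final and all its transitions are sends. -/
def Machine.Sending (M : Machine A S) (q : S) : Prop :=
  ¬ M.Final q ∧ ∀ ℓ q', M.trans q ℓ q' → Act.dir ℓ = true

/-- A state is receiving iff it is not final and all its transitions are receives. -/
def Machine.Receiving (M : Machine A S) (q : S) : Prop :=
  ¬ M.Final q ∧ ∀ ℓ q', M.trans q ℓ q' → Act.dir ℓ = false

/-- `in(q)`: messages receivable at `q`. -/
def Machine.inSet (M : Machine A S) (q : S) : Set A := {a | ∃ q', M.trans q (.recv a) q'}

/-- `out(q)`: messages sendable at `q`. -/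
def Machine.outSet (M : Machine A S) (q : S) : Set A := {a | ∃ q', M.trans q (.send a) q'}

/-- Multi-step transition along a list of actions. -/
inductive ActPath (M : Machine A S) : S → List (Act A) → S → Prop
  | nil (q : S) : ActPath M q [] q
  | cons {q : S} {ℓ : Act A} {q₁ : S} {ψ : List (Act A)} {q' : S} :
      M.trans q ℓ q₁ → ActPath M q₁ ψ q' → ActPath M q (ℓ :: ψ) q'

/-- `cycle(!,q)`: a cycle of send actions is reachable from `q` via sends. -/
def SendCycle (M : Machine A S) (q : S) : Prop :=
  ∃ (ω ω' : List A) (q' : S),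
    ActPath M q (ω.map Act.send) q' ∧ ω' ≠ [] ∧ ActPath M q' (ω'.map Act.send) q'

/-- Input trees over alphabet `A` and states `S`: either a single state (a hole
filled with a state), or a nonempty finite input branching `⟨a_i : T_i⟩`. -/
inductive ITree (A S : Type) : Type
  | leaf : S → ITree A S
  | node : (dom : Finset A) → dom.Nonempty → ((a : A) → a ∈ dom → ITree A S) → ITree A S

/-- The set of states occurring at the leaves of an input tree (equivalently, the
states in the holes of the corresponding input context). -/
def ITree.leaves : ITree A S → Set S
  | .leaf q => {q}
  | .node dom _ f => {s | ∃ (a : A) (h : a ∈ dom), s ∈ (f a h).leaves}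

/-- `minHeight`: the length of a shortest root-to-leaf (root-to-hole) path. -/
noncomputable def ITree.minHeight : ITree A S → ℕ
  | .leaf _ => 0
  | .node dom _ f => 1 + sInf {h | ∃ (a : A) (ha : a ∈ dom), (f a ha).minHeight = h}
termination_by structural t => t

open Classical in
/-- `extract(𝒜,ω)`: follow the word `ω` of input messages down the tree. -/
noncomputable def ITree.extract : ITree A S → List A → Option (ITree A S)
  | t, [] => some t
  | .leaf _, _ :: _ => none
  | .node dom _ f, a :: ω => if h : a ∈ dom then (f a h).extract ω else none
termination_by structural t => t

/-- Replace every leaf `q` of a tree by some tree `t` with `R q t`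
(filling of an input context, relationally). -/
inductive ReplaceLeaves (R : S → ITree A S → Prop) : ITree A S → ITree A S → Prop
  | leaf {q : S} {t : ITree A S} : R q t → ReplaceLeaves R (.leaf q) t
  | node {dom : Finset A} {hne : dom.Nonempty} {f g : (a : A) → a ∈ dom → ITree A S} :
      (∀ a (h : a ∈ dom), ReplaceLeaves R (f a h) (g a h)) →
      ReplaceLeaves R (.node dom hne f) (.node dom hne g)

/-- `InTree M q T` holds iff `inTree(q)` is defined and equals `T`. -/
inductive InTree (M : Machine A S) : S → ITree A S → Prop
  | leaf {q : S} : M.inSet q = ∅ → InTree M q (.leaf q)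
  | node {q : S} {dom : Finset A} {hne : dom.Nonempty}
      {f : (a : A) → a ∈ dom → ITree A S} :
      (↑dom : Set A) = M.inSet q →
      (∀ a (h : a ∈ dom), ∀ q', M.trans q (.recv a) q' → InTree M q' (f a h)) →
      InTree M q (.node dom hne f)

/-- `AccTree M ω q t` holds iff `accTree(q,ω)` is defined and equals `t`. -/
def AccTree (M : Machine A S) : List A → S → ITree A S → Prop
  | [], q, t => t = .leaf q
  | a :: ω, q, t =>
      ∃ T, InTree M q T ∧
        ReplaceLeaves (fun p t' => ∃ p', M.trans p (.send a) p' ∧ AccTree M ω p' t') T t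

/-- `rcv(ψ)`: the messages of the receive actions in `ψ`, in order. -/
def rcvWord (ψ : List (Act A)) : List A :=
  ψ.filterMap fun ℓ => match ℓ with | .recv a => some a | .send _ => none

/-- `snd(ψ)`: the messages of the send actions in `ψ`, in order. -/
def sndWord (ψ : List (Act A)) : List A :=
  ψ.filterMap fun ℓ => match ℓ with | .send a => some a | .recv _ => none

/-- `MinAcc M ψ k Qs r` holds iff `minAcc(k,Qs,ψ)` is defined and equals `r`. -/
def MinAcc (M : Machine A S) : List (Act A) → ℕ → Set S → ℕ → Prop
  | [], k, _, r => r = k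
  | .recv _ :: ψ, k, Qs, r => 0 < k ∧ MinAcc M ψ (k - 1) Qs r
  | .send a :: ψ, k, Qs, r =>
      Qs.Nonempty ∧
      ∃ T : S → ITree A S,
        (∀ q ∈ Qs, AccTree M [a] q (T q)) ∧
        MinAcc M ψ (k + sInf {h | ∃ q ∈ Qs, (T q).minHeight = h})
          {q' | ∃ q ∈ Qs, q' ∈ (T q).leaves} r

/-- One step of the asynchronous subtyping simulation game, on configurations
`(p,T)` with `p` a state of `M₁` and `T` an input tree over the states of `M₂`.
The four rules are (In), (Out), (InCtx) and (OutAcc). -/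
inductive Step (M1 : Machine A P) (M2 : Machine A Q) :
    P × ITree A Q → Act A → P × ITree A Q → Prop
  | inp {p : P} {q : Q} {a : A} {p' : P} {q' : Q} :
      M1.trans p (.recv a) p' → M2.trans q (.recv a) q' →
      M2.inSet q ⊆ M1.inSet p →
      Step M1 M2 (p, .leaf q) (.recv a) (p', .leaf q')
  | out {p : P} {q : Q} {a : A} {p' : P} {q' : Q} :
      M1.trans p (.send a) p' → M2.trans q (.send a) q' →
      M1.outSet p ⊆ M2.outSet q →
      Step M1 M2 (p, .leaf q) (.send a) (p', .leaf q')
  | inCtx {p : P} {a : A} {p' : P} {dom : Finset A} {hne : dom.Nonempty}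
      {f : (b : A) → b ∈ dom → ITree A Q} (h : a ∈ dom) :
      M1.trans p (.recv a) p' → (↑dom : Set A) ⊆ M1.inSet p →
      Step M1 M2 (p, .node dom hne f) (.recv a) (p', f a h)
  | outAcc {p : P} {a : A} {p' : P} {T T' : ITree A Q} :
      M1.trans p (.send a) p' → ¬ SendCycle M1 p →
      ReplaceLeaves (fun q t => ∃ U, InTree M2 q U ∧
          ReplaceLeaves (fun qh t' => M1.outSet p ⊆ M2.outSet qh ∧
              ∃ q', M2.trans qh (.send a) q' ∧ t' = .leaf q') U t) T T' →
      Step M1 M2 (p, T) (.send a) (p', T')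

/-- The root configuration of the simulation tree. -/
def initConfig (M1 : Machine A P) (M2 : Machine A Q) : P × ITree A Q :=
  (M1.init, .leaf M2.init)

def StepAny (M1 : Machine A P) (M2 : Machine A Q) (c c' : P × ITree A Q) : Prop :=
  ∃ ℓ, Step M1 M2 c ℓ c'

/-- Configurations reachable from the root, i.e. the labels of the nodes of
the simulation tree `simtree(M₁,M₂)`. -/
def CReach (M1 : Machine A P) (M2 : Machine A Q) (c : P × ITree A Q) : Prop :=
  Relation.ReflTransGen (StepAny M1 M2) (initConfig M1 M2) c

/-- A successful leaf: a pair of final states with empty input context. -/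
def SuccessfulConfig (M1 : Machine A P) (M2 : Machine A Q) (c : P × ITree A Q) : Prop :=
  ∃ p q, c = (p, ITree.leaf q) ∧ M1.Final p ∧ M2.Final q

/-- All branches of `simtree(M₁,M₂)` are successful: every branch is infinite or
ends in a successful leaf, i.e. every reachable node without successors is a
successful leaf. -/
def AllBranchesSuccessful (M1 : Machine A P) (M2 : Machine A Q) : Prop :=
  ∀ c, CReach M1 M2 c → (∀ ℓ c', ¬ Step M1 M2 c ℓ c') → SuccessfulConfig M1 M2 c

/-- Asynchronous subtyping relations (Definition of asynchronous subtyping). -/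
def IsSubtypingRel (M1 : Machine A P) (M2 : Machine A Q)
    (R : P → ITree A Q → Prop) : Prop :=
  ∀ p T, R p T →
    (M1.Final p → ∃ q, T = ITree.leaf q ∧ M2.Final q) ∧
    (M1.Receiving p →
      (∀ q, T = ITree.leaf q →
        M2.Receiving q ∧
        ∀ a q', M2.trans q (.recv a) q' →
          ∃ p', M1.trans p (.recv a) p' ∧ R p' (ITree.leaf q')) ∧
      (∀ (dom : Finset A) (hne : dom.Nonempty) (f : (a : A) → a ∈ dom → ITree A Q),
        T = ITree.node dom hne f →
        ∀ a (h : a ∈ dom), ∃ p', M1.trans p (.recv a) p' ∧ R p' (f a h))) ∧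
    (M1.Sending p →
      (∀ q, T = ITree.leaf q → M2.Sending q →
        ∀ a p', M1.trans p (.send a) p' →
          ∃ q', M2.trans q (.send a) q' ∧ R p' (ITree.leaf q')) ∧
      ((¬ ∃ q, T = ITree.leaf q ∧ M2.Sending q) →
        ¬ SendCycle M1 p ∧
        (∀ q ∈ T.leaves, ∃ U, InTree M2 q U) ∧
        (∀ a p', M1.trans p (.send a) p' →
          ∃ T', ReplaceLeaves (fun q t => ∃ U, InTree M2 q U ∧
              ReplaceLeaves (fun qh t' => ∃ q', M2.trans qh (.send a) q' ∧
                  t' = ITree.leaf q') U t) T T' ∧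
            R p' T')))

/-- `M₁ ≤ M₂`: asynchronous session subtyping. -/
def Subtyping (M1 : Machine A P) (M2 : Machine A Q) : Prop :=
  ∃ R, IsSubtypingRel M1 M2 R ∧ R M1.init (ITree.leaf M2.init)

/-! ### Nodes of the simulation tree and (candidate/witness) subtrees -/

/-- A node of the simulation tree: the sequence of edge labels from the root
together with the configuration labelling the node. -/
abbrev SNode (A P Q : Type) := List (Act A) × (P × ITree A Q)

/-- The root node of the simulation tree. -/
def rootNode (M1 : Machine A P) (M2 : Machine A Q) : SNode A P Q :=
  ([], initConfig M1 M2)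

/-- Labelled edges of the simulation tree. -/
def Edge (M1 : Machine A P) (M2 : Machine A Q)
    (n : SNode A P Q) (ℓ : Act A) (n' : SNode A P Q) : Prop :=
  n'.1 = n.1 ++ [ℓ] ∧ Step M1 M2 n.2 ℓ n'.2

def EdgeAny (M1 : Machine A P) (M2 : Machine A Q) (n n' : SNode A P Q) : Prop :=
  ∃ ℓ, Edge M1 M2 n ℓ n'

/-- `n ↝* n'`. -/
def NReach (M1 : Machine A P) (M2 : Machine A Q) : SNode A P Q → SNode A P Q → Prop :=
  Relation.ReflTransGen (EdgeAny M1 M2)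

/-- `n ↝⁺ n'`. -/
def NReachPlus (M1 : Machine A P) (M2 : Machine A Q) : SNode A P Q → SNode A P Q → Prop :=
  Relation.TransGen (EdgeAny M1 M2)

/-- `n ↝^ψ n'`: path with label sequence `ψ`. -/
inductive EdgePath (M1 : Machine A P) (M2 : Machine A Q) :
    SNode A P Q → List (Act A) → SNode A P Q → Prop
  | nil (n : SNode A P Q) : EdgePath M1 M2 n [] n
  | cons {n : SNode A P Q} {ℓ : Act A} {n₁ : SNode A P Q} {ψ : List (Act A)}
      {n' : SNode A P Q} :
      Edge M1 M2 n ℓ n₁ → EdgePath M1 M2 n₁ ψ n' → EdgePath M1 M2 n (ℓ :: ψ) n'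

/-- Data of a subtree of the simulation tree: a root `r`, a boundary `B`, and an
ancestor function `anc` (only its values on `B` matter). -/
structure SubtreeData (A P Q : Type) where
  r : SNode A P Q
  B : Set (SNode A P Q)
  anc : SNode A P Q → SNode A P Q

/-- `nodes(r,B)`: the nodes of the finite subtree. -/
def SubtreeData.nodes (W : SubtreeData A P Q) (M1 : Machine A P) (M2 : Machine A Q) :
    Set (SNode A P Q) :=
  {n | NReach M1 M2 W.r n ∧ ∃ b ∈ W.B, NReach M1 M2 n b}

/-- `(r,B)` is a finite subtree of `simtree(M₁,M₂)`. -/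
def SubtreeData.IsFiniteSubtree (W : SubtreeData A P Q)
    (M1 : Machine A P) (M2 : Machine A Q) : Prop :=
  NReach M1 M2 (rootNode M1 M2) W.r ∧
  W.B.Finite ∧
  (∀ n ∈ W.B, NReach M1 M2 W.r n) ∧
  (∀ n ∈ W.B, ∀ n' ∈ W.B, ¬ NReachPlus M1 M2 n n') ∧
  (∀ n, NReach M1 M2 W.r n → ∃ n' ∈ W.B, NReach M1 M2 n n' ∨ NReach M1 M2 n' n)

/-- `(r,B,anc)` is a candidate subtree of `simtree(M₁,M₂)`. -/
def SubtreeData.IsCandidate (W : SubtreeData A P Q)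
    (M1 : Machine A P) (M2 : Machine A Q) : Prop :=
  W.IsFiniteSubtree M1 M2 ∧
  ∀ n ∈ W.B,
    W.anc n ∈ W.nodes M1 M2 \ W.B ∧
    NReachPlus M1 M2 (W.anc n) n ∧
    n.2.1 = (W.anc n).2.1 ∧
    (n.2.2).leaves ⊆ ((W.anc n).2.2).leaves

/-- `tr(n)`: `n` itself if it is not a boundary node, its ancestor otherwise. -/
noncomputable def SubtreeData.tr (W : SubtreeData A P Q) (n : SNode A P Q) : SNode A P Q := by
  classical exact if n ∈ W.B then W.anc n else n

/-! ### Input tree expressions, systems of input tree equations, compatibility -/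

/-- Input tree expressions over alphabet `A` and variables `V`:
variables, input choices, and silent choices. -/
inductive ITExpr (A V : Type) : Type
  | var : V → ITExpr A V
  | inp : (dom : Finset A) → dom.Nonempty → ((a : A) → a ∈ dom → ITExpr A V) → ITExpr A V
  | sil : ITExpr A V → List (ITExpr A V) → ITExpr A V

/-- Turn an input tree into an input tree expression by replacing each leaf
state `q` by the variable `v q`. -/
def ITree.toExprVar : ITree A S → (S → V) → ITExpr A V
  | .leaf q, v => .var (v q)
  | .node dom hne f, v => .inp dom hne fun a h => (f a h).toExprVar v

/-- Relational version: replace each leaf `q` by some expression `e` with `R q e`. -/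
inductive ToExpr (R : S → ITExpr A V → Prop) : ITree A S → ITExpr A V → Prop
  | leaf {q : S} {e : ITExpr A V} : R q e → ToExpr R (.leaf q) e
  | node {dom : Finset A} {hne : dom.Nonempty} {f : (a : A) → a ∈ dom → ITree A S}
      {g : (a : A) → a ∈ dom → ITExpr A V} :
      (∀ a (h : a ∈ dom), ToExpr R (f a h) (g a h)) →
      ToExpr R (.node dom hne f) (.inp dom hne g)

/-- Compatibility relations between two systems of input tree equations, given by
their definition maps `defL` and `defR`. -/
def IsCompatRel (defL : V → ITExpr A V) (defR : W' → ITExpr A W')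
    (R : ITExpr A V → ITExpr A W' → Prop) : Prop :=
  (∀ (X : V) (E : ITExpr A W'), R (.var X) E → R (defL X) E) ∧
  (∀ (E : ITExpr A V) (X : W'), R E (.var X) → R E (defR X)) ∧
  (∀ (e₀ : ITExpr A V) (es : List (ITExpr A V)) (E : ITExpr A W'),
      R (.sil e₀ es) E → ∀ e ∈ e₀ :: es, R e E) ∧
  (∀ (E : ITExpr A V) (e₀ : ITExpr A W') (es : List (ITExpr A W')),
      R E (.sil e₀ es) → ∀ e ∈ e₀ :: es, R E e) ∧
  (∀ (dom : Finset A) (hne : dom.Nonempty) (f : (a : A) → a ∈ dom → ITExpr A V)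
      (dom' : Finset A) (hne' : dom'.Nonempty) (g : (a : A) → a ∈ dom' → ITExpr A W'),
      R (.inp dom hne f) (.inp dom' hne' g) →
      dom ⊆ dom' ∧ ∀ a (h : a ∈ dom) (h' : a ∈ dom'), R (f a h) (g a h'))

/-- `E ⊑ E'`: compatibility of two expressions w.r.t. the definition maps. -/
def Compat (defL : V → ITExpr A V) (defR : W' → ITExpr A W')
    (E : ITExpr A V) (E' : ITExpr A W') : Prop :=
  ∃ R, IsCompatRel defL defR R ∧ R E E'

/-- Specification of the system `𝒢` of condition (3a) of the witness-subtree
definition: variables are `X₀` (`none`) and `X_{q,n}` (`some (q,n)`). -/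
def GSpec (M1 : Machine A P) (M2 : Machine A Q) (W : SubtreeData A P Q)
    (EG : Option (Q × SNode A P Q) → ITExpr A (Option (Q × SNode A P Q))) : Prop :=
  ToExpr (fun q e => e = .var (some (q, W.r))) (W.r.2.2) (EG none) ∧
  ∀ (q : Q), ∀ n ∈ W.nodes M1 M2 \ W.B,
    ((∃ a n', Edge M1 M2 n (.recv a) n') →
       ∃ e₀ es, EG (some (q, n)) = .sil e₀ es ∧
         ∀ e, e ∈ e₀ :: es ↔ ∃ a n', Edge M1 M2 n (.recv a) n' ∧
           e = .var (some (q, W.tr n'))) ∧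
    ((¬ ∃ a n', Edge M1 M2 n (.recv a) n') → (∃ a n', Edge M1 M2 n (.send a) n') →
       ∃ e₀ es, EG (some (q, n)) = .sil e₀ es ∧
         ∀ e, e ∈ e₀ :: es ↔ ∃ a n', Edge M1 M2 n (.send a) n' ∧
           ∃ U, InTree M2 q U ∧
             ToExpr (fun qi e' => ∃ q', M2.trans qi (.send a) q' ∧
               e' = .var (some (q', W.tr n'))) U e)

/-- Specification of the system `𝒢'` of condition (3b) of the witness-subtree
definition: variables are `Y_n`. -/
def G'Spec (M1 : Machine A P) (M2 : Machine A Q) (W : SubtreeData A P Q)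
    (EG' : SNode A P Q → ITExpr A (SNode A P Q)) : Prop :=
  ∀ n ∈ W.nodes M1 M2 \ W.B,
    ((∃ a n', Edge M1 M2 n (.send a) n') →
       ∃ e₀ es, EG' n = .sil e₀ es ∧
         ∀ e, e ∈ e₀ :: es ↔ ∃ a n', Edge M1 M2 n (.send a) n' ∧ e = .var (W.tr n')) ∧
    ((∃ a n', Edge M1 M2 n (.recv a) n') →
       ∃ (dom : Finset A) (hne : dom.Nonempty) (g : (a : A) → a ∈ dom → ITExpr A (SNode A P Q)),
         EG' n = .inp dom hne g ∧
         (↑dom : Set A) = {a | ∃ n', Edge M1 M2 n (.recv a) n'} ∧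
         ∀ a (h : a ∈ dom), ∀ n', Edge M1 M2 n (.recv a) n' → g a h = .var (W.tr n'))

/-- `(r,B,anc)` is a witness subtree of `simtree(M₁,M₂)`. -/
def SubtreeData.IsWitness (W : SubtreeData A P Q)
    (M1 : Machine A P) (M2 : Machine A Q) : Prop :=
  W.IsCandidate M1 M2 ∧
  -- (1) at least one receive action between an ancestor and its boundary node
  (∀ n ∈ W.B, ∀ ψ, EdgePath M1 M2 (W.anc n) ψ n → 0 < (rcvWord ψ).length) ∧
  -- (2) conditions (2a) and (2b)
  (∀ n ∈ W.anc '' W.B, ∀ n' ∈ W.anc '' W.B ∪ W.B, ∀ ψ, EdgePath M1 M2 n ψ n' →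
    (∀ q ∈ (n.2.2).leaves,
        ∃ t, AccTree M2 (sndWord ψ) q t ∧ t.leaves ⊆ (n'.2.2).leaves) ∧
    (n' ∈ W.B →
        ∃ m, MinAcc M2 ψ ((n.2.2).minHeight) ((n.2.2).leaves) m ∧
          (n.2.2).minHeight ≤ m)) ∧
  -- (3) compatibility of the two systems of input tree equations
  (∃ EG EG', GSpec M1 M2 W EG ∧ G'Spec M1 M2 W EG' ∧
      Compat EG EG' (ITExpr.var none) (ITExpr.var W.r))


theorem ReplaceLeaves.mono' {R R' : S → ITree A S → Prop} (hR : ∀ q t, R q t → R' q t)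
    {T T' : ITree A S} (h : ReplaceLeaves R T T') : ReplaceLeaves R' T T' := by
  induction h with
  | leaf h => exact .leaf (hR _ _ h)
  | node _ ih => exact .node ih

theorem ReplaceLeaves.exists_of {R R' : S → ITree A S → Prop}
    (hR : ∀ q t, R q t → ∃ t', R' q t')
    {T T' : ITree A S} (h : ReplaceLeaves R T T') : ∃ T'', ReplaceLeaves R' T T'' := by
  induction h with
  | leaf h =>
    obtain ⟨t', ht⟩ := hR _ _ h
    exact ⟨t', .leaf ht⟩
  | node _ ih =>
    choose g hg using ih
    exact ⟨_, .node hg⟩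

theorem ReplaceLeaves.on_leaves {R : S → ITree A S → Prop}
    {T T' : ITree A S} (h : ReplaceLeaves R T T') : ∀ q ∈ T.leaves, ∃ t, R q t := by
  induction h with
  | leaf h =>
    intro q hq
    simp only [ITree.leaves, Set.mem_singleton_iff] at hq
    subst hq
    exact ⟨_, h⟩
  | node _ ih =>
    intro q hq
    simp only [ITree.leaves, Set.mem_setOf_eq] at hq
    obtain ⟨a, ha, hq⟩ := hq
    exact ih a ha q hq

theorem outSet_sub_of_outAcc {M1 : Machine A P} {M2 : Machine A Q} {p : P} {b : A} {q : Q}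
    {T' : ITree A Q} (hq : M2.Sending q)
    (h : ReplaceLeaves (fun q t => ∃ U, InTree M2 q U ∧
          ReplaceLeaves (fun qh t' => M1.outSet p ⊆ M2.outSet qh ∧
              ∃ q', M2.trans qh (.send b) q' ∧ t' = .leaf q') U t) (.leaf q) T') :
    M1.outSet p ⊆ M2.outSet q := by
  cases h with
  | leaf h =>
    obtain ⟨U, hU, hr⟩ := h
    cases hU with
    | leaf _ =>
      cases hr with
      | leaf h => exact h.1
    | @node _ dom hne f hd _ =>
      obtain ⟨a, ha⟩ := hne
      have : a ∈ M2.inSet q := by rw [← hd]; exact ha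
      obtain ⟨q', hq'⟩ := this
      have := hq.2 _ _ hq'
      simp [Act.dir] at this

theorem sub_rel (M1 : Machine A P) (M2 : Machine A Q) (h : AllBranchesSuccessful M1 M2) :
    IsSubtypingRel M1 M2 (fun p T => CReach M1 M2 (p, T)) := by
  intro p T hR
  have next : ∀ {ℓ c}, Step M1 M2 (p, T) ℓ c → CReach M1 M2 c :=
    fun hs => Relation.ReflTransGen.tail hR ⟨_, hs⟩
  have key : (∃ q, T = .leaf q ∧ M1.Final p ∧ M2.Final q) ∨ ∃ ℓ c, Step M1 M2 (p, T) ℓ c := by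
    by_cases hs : ∃ ℓ c, Step M1 M2 (p, T) ℓ c
    · exact .inr hs
    · push Not at hs
      obtain ⟨p', q, he, h1, h2⟩ := h _ hR hs
      cases he
      exact .inl ⟨q, rfl, h1, h2⟩
  refine ⟨?_, ?_, ?_⟩
  · intro hf
    rcases key with ⟨q, h1, _, h2⟩ | ⟨ℓ, c, hs⟩
    · exact ⟨q, h1, h2⟩
    · exfalso
      cases hs with
      | inp h1 _ _ => exact hf _ _ h1
      | out h1 _ _ => exact hf _ _ h1
      | inCtx _ h1 _ => exact hf _ _ h1
      | outAcc h1 _ _ => exact hf _ _ h1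
  · intro hp
    rcases key with ⟨q, _, h1, _⟩ | ⟨ℓ, c, hs⟩
    · exact absurd h1 hp.1
    · cases hs with
      | out h1 _ _ => have := hp.2 _ _ h1; simp [Act.dir] at this
      | outAcc h1 _ _ => have := hp.2 _ _ h1; simp [Act.dir] at this
      | inp h1 h2 h3 =>
        refine ⟨?_, fun _ _ _ he => by cases he⟩
        intro q he
        cases he
        refine ⟨⟨fun hf => hf _ _ h2, fun ℓ q' ht => M2.directed _ _ _ _ _ ht h2⟩, ?_⟩
        intro a q' hq'
        obtain ⟨p', hp'⟩ := h3 ⟨q', hq'⟩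
        exact ⟨p', hp', next (.inp hp' hq' h3)⟩
      | inCtx hm h1 h2 =>
        refine ⟨fun _ he => by (cases he), ?_⟩
        intro dom hne f he a ha
        cases he
        obtain ⟨p', hp'⟩ := h2 ha
        exact ⟨p', hp', next (.inCtx ha hp' h2)⟩
  · intro hp
    rcases key with ⟨q, _, h1, _⟩ | ⟨ℓ, c, hs⟩
    · exact absurd h1 hp.1
    · cases hs with
      | inp h1 _ _ => have := hp.2 _ _ h1; simp [Act.dir] at this
      | inCtx _ h1 _ => have := hp.2 _ _ h1; simp [Act.dir] at this
      | out h1 h2 h3 =>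
        refine ⟨?_, ?_⟩
        · intro q he _ a p' hp'
          cases he
          obtain ⟨q', hq'⟩ := h3 ⟨p', hp'⟩
          exact ⟨q', hq', next (.out hp' hq' h3)⟩
        · intro hn
          exact absurd ⟨_, rfl, fun hf => hf _ _ h2,
            fun ℓ q' ht => M2.directed _ _ _ _ _ ht h2⟩ hn
      | outAcc h1 h2 h3 =>
        refine ⟨?_, ?_⟩
        · intro q he hq a p' hp'
          cases he
          have hsub := outSet_sub_of_outAcc hq h3
          obtain ⟨q', hq'⟩ := hsub ⟨p', hp'⟩
          exact ⟨q', hq', next (.out hp' hq' hsub)⟩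
        · intro _
          refine ⟨h2, ?_, ?_⟩
          · intro q hq
            obtain ⟨t, U, hU, _⟩ := h3.on_leaves q hq
            exact ⟨U, hU⟩
          · intro a p' hp'
            obtain ⟨T'', hT⟩ := h3.exists_of (R' := fun q t => ∃ U, InTree M2 q U ∧
                ReplaceLeaves (fun qh t' => M1.outSet p ⊆ M2.outSet qh ∧
                  ∃ q', M2.trans qh (.send a) q' ∧ t' = .leaf q') U t) (by
              rintro q t ⟨U, hU, hr⟩
              obtain ⟨t', ht'⟩ := hr.exists_of (R' := fun qh t' => M1.outSet p ⊆ M2.outSet qh ∧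
                  ∃ q', M2.trans qh (.send a) q' ∧ t' = .leaf q') (by
                rintro qh _ ⟨hsub, _⟩
                obtain ⟨q', hq'⟩ := hsub ⟨p', hp'⟩
                exact ⟨_, hsub, q', hq', rfl⟩)
              exact ⟨t', U, hU, ht'⟩)
            refine ⟨T'', hT.mono' ?_, next (.outAcc hp' h2 hT)⟩
            rintro q t ⟨U, hU, hr⟩
            exact ⟨U, hU, hr.mono' fun _ _ hh => hh.2⟩

/-- If all branches of `simtree(M₁,M₂)` are successful, then the
set of node labels of the simulation tree is an asynchronous subtyping relation,
and hence `M₁ ≤ M₂`. -/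
theorem reachable_labels_subtyping_rel
    {A P Q : Type} [Fintype A] [Fintype P] [Fintype Q]
    (M1 : Machine A P) (M2 : Machine A Q)
    (h : AllBranchesSuccessful M1 M2) :
    IsSubtypingRel M1 M2 (fun p T => CReach M1 M2 (p, T)) ∧ Subtyping M1 M2 := 
  ⟨sub_rel M1 M2 h, _, sub_rel M1 M2 h, Relation.ReflTransGen.refl⟩

end AsyncSession
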